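/- Let α ∈ (0,1). Then lim_{x → +∞} x · E_α(−x) = 1/Γ(1−α); i.e., the Mittag-Leffler function satisfies the algebraic decay asymptotics E_α(−x) ∼ 1/(x Γ(1−α)) as x → +∞. -/

import Mathlib

open Filter

/-- The coefficient of `z ^ n` in the binomial series of `(1 - z) ^ (-y)`. -/
noncomputable def risingBinomial (y : ℝ) (n : ℕ) : ℝ :=
  (∏ j ∈ Finset.range n, (y + j)) / n.factorial

@[simp] lemma risingBinomial_zero (y : ℝ) : risingBinomial y 0 = 1 := by
  simp [risingBinomial]

lemma risingBinomial_succ (y : ℝ) (n : ℕ) :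
    (n + 1) * risingBinomial y (n + 1) = risingBinomial y n * (y + n) := by
  have h : (n.factorial : ℝ) ≠ 0 := by positivity
  rw [risingBinomial, risingBinomial, Finset.prod_range_succ, Nat.factorial_succ]
  push_cast
  field_simp

lemma risingBinomial_nonneg {y : ℝ} (hy : 0 ≤ y) (n : ℕ) : 0 ≤ risingBinomial y n :=
  div_nonneg (Finset.prod_nonneg fun _ _ => by positivity) (by positivity)

lemma risingBinomial_neg_nonpos {a : ℝ} (h0 : 0 ≤ a) (h1 : a ≤ 1) (n : ℕ) :
    risingBinomial (-a) (n + 1) ≤ 0 := by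
  induction n with
  | zero =>
    have h := risingBinomial_succ (-a) 0
    simp at h
    simpa [h] using h0
  | succ n ih =>
    have h := risingBinomial_succ (-a) (n + 1)
    have h2 : risingBinomial (-a) (n + 1) * (-a + ((n + 1 : ℕ) : ℝ)) ≤ 0 := by
      refine mul_nonpos_of_nonpos_of_nonneg ih ?_
      push_cast
      linarith [(Nat.cast_nonneg n : (0 : ℝ) ≤ n)]
    rw [← h] at h2
    have h3 : (0 : ℝ) < ((n + 1 : ℕ) : ℝ) + 1 := by positivity
    by_contra! hc
    linarith [mul_pos h3 hc]

/-- Vandermonde's convolution identity for the coefficients of the binomial series. -/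
lemma sum_antidiagonal_risingBinomial (a b : ℝ) (n : ℕ) :
    ∑ p ∈ Finset.HasAntidiagonal.antidiagonal n, risingBinomial a p.1 * risingBinomial b p.2
      = risingBinomial (a + b) n := by
  induction n with
  | zero => simp
  | succ n ih =>
    have hn : (n + 1 : ℝ) ≠ 0 := by positivity
    apply mul_left_cancel₀ hn
    have e1 : ∑ p ∈ Finset.HasAntidiagonal.antidiagonal (n + 1),
        (p.1 : ℝ) * (risingBinomial a p.1 * risingBinomial b p.2)
        = ∑ p ∈ Finset.HasAntidiagonal.antidiagonal n,
          (a + p.1) * (risingBinomial a p.1 * risingBinomial b p.2) := by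
      rw [Finset.Nat.sum_antidiagonal_succ]
      simp only [Nat.cast_zero, zero_mul, zero_add]
      refine Finset.sum_congr rfl fun p _ => ?_
      push_cast
      rw [← mul_assoc, risingBinomial_succ]
      ring
    have e2 : ∑ p ∈ Finset.HasAntidiagonal.antidiagonal (n + 1),
        (p.2 : ℝ) * (risingBinomial a p.1 * risingBinomial b p.2)
        = ∑ p ∈ Finset.HasAntidiagonal.antidiagonal n,
          (b + p.2) * (risingBinomial a p.1 * risingBinomial b p.2) := by
      rw [Finset.Nat.sum_antidiagonal_succ']
      simp only [Nat.cast_zero, zero_mul, zero_add]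
      refine Finset.sum_congr rfl fun p _ => ?_
      push_cast
      rw [mul_left_comm, risingBinomial_succ]
      ring
    rw [risingBinomial_succ, ← ih, Finset.mul_sum, Finset.sum_mul]
    calc _ = ∑ p ∈ Finset.HasAntidiagonal.antidiagonal (n + 1),
          ((p.1 : ℝ) * (risingBinomial a p.1 * risingBinomial b p.2)
          + (p.2 : ℝ) * (risingBinomial a p.1 * risingBinomial b p.2)) := by
          refine Finset.sum_congr rfl fun p hp => ?_
          have h : (p.1 : ℝ) + p.2 = n + 1 := by
            exact_mod_cast Finset.HasAntidiagonal.mem_antidiagonal.mp hp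
          rw [← h]
          ring
      _ = _ := by
          rw [Finset.sum_add_distrib, e1, e2, ← Finset.sum_add_distrib]
          refine Finset.sum_congr rfl fun p hp => ?_
          have h : (p.1 : ℝ) + p.2 = n := by
            exact_mod_cast Finset.HasAntidiagonal.mem_antidiagonal.mp hp
          rw [← h]
          ring

lemma summable_pow_mul_risingBinomial {α β r : ℝ} (hα : 0 ≤ α) (hβ : 0 ≤ β)
    (hr : 0 < r) (hr1 : r < 1) (n : ℕ) :
    Summable fun k : ℕ => r ^ k * risingBinomial (α * k + β) n := by
  have hs : Summable fun k : ℕ => ((k : ℝ) + 1) ^ n * r ^ k := by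
    have h := (summable_nat_add_iff 1).mpr
      (summable_pow_mul_geometric_of_norm_lt_one n (r := r)
        (by rwa [Real.norm_of_nonneg hr.le]))
    refine (h.mul_left r⁻¹).congr fun k => ?_
    push_cast
    rw [pow_succ]
    field_simp
  refine Summable.of_nonneg_of_le
    (fun k => mul_nonneg (by positivity) (risingBinomial_nonneg (by positivity) n)) (fun k => ?_)
    (hs.mul_left ((α + β + n) ^ n))
  have h1 : risingBinomial (α * k + β) n ≤ ∏ j ∈ Finset.range n, (α * k + β + j) :=
    div_le_self (Finset.prod_nonneg fun _ _ => by positivity)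
      (by exact_mod_cast Nat.one_le_iff_ne_zero.mpr (Nat.factorial_ne_zero n))
  have h2 : ∏ j ∈ Finset.range n, (α * k + β + (j : ℝ)) ≤ ((α + β + n) * (k + 1)) ^ n := by
    refine (Finset.prod_le_prod (fun _ _ => by positivity) fun j hj => ?_).trans_eq
      (by rw [Finset.prod_const, Finset.card_range])
    have hj' : (j : ℝ) ≤ n := by exact_mod_cast (Finset.mem_range.mp hj).le
    nlinarith [mul_nonneg hβ (Nat.cast_nonneg k : (0 : ℝ) ≤ k),
      mul_nonneg (Nat.cast_nonneg n : (0 : ℝ) ≤ n) (Nat.cast_nonneg k : (0 : ℝ) ≤ k)]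
  calc r ^ k * risingBinomial (α * k + β) n ≤ r ^ k * ((α + β + n) * (k + 1)) ^ n := by
        gcongr
        exact h1.trans h2
    _ = _ := by rw [mul_pow]; ring

/-- The `n`-th coefficient of `(1 - z) ^ (α - β) / ((1 - z) ^ α + r)` is nonnegative
when `α ≤ β`; here it is written as the expansion in powers of `r`. -/
lemma tsum_neg_pow_mul_risingBinomial_nonneg {α β r : ℝ} (hα : 0 ≤ α) (hα1 : α ≤ 1)
    (hβ : α ≤ β) (hr : 0 < r) (hr1 : r < 1) (n : ℕ) :
    0 ≤ ∑' k : ℕ, (-r) ^ k * risingBinomial (α * k + β) n := by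
  set w : ℕ → ℝ := fun n => ∑' k : ℕ, (-r) ^ k * risingBinomial (α * k + β) n
  have hsum : ∀ n, HasSum (fun k : ℕ => (-r) ^ k * risingBinomial (α * k + β) n) (w n) := by
    intro n
    refine (Summable.of_norm_bounded
      (summable_pow_mul_risingBinomial hα (hα.trans hβ) hr hr1 n) fun k => ?_).hasSum
    rw [norm_mul, norm_pow, norm_neg, Real.norm_of_nonneg hr.le,
      Real.norm_of_nonneg (risingBinomial_nonneg (by have := hα.trans hβ; positivity) n)]
  have hconv : ∀ n, ∑ p ∈ Finset.HasAntidiagonal.antidiagonal n,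
      risingBinomial (-α) p.1 * w p.2 + r * w n = risingBinomial (β - α) n := by
    intro n
    have h1 : HasSum (fun k : ℕ => (-r) ^ k * risingBinomial (α * k + β - α) n)
        (∑ p ∈ Finset.HasAntidiagonal.antidiagonal n, risingBinomial (-α) p.1 * w p.2) := by
      have h := hasSum_sum (s := Finset.HasAntidiagonal.antidiagonal n) fun p _ =>
        (hsum p.2).mul_left (risingBinomial (-α) p.1)
      have hterm : (fun k : ℕ => (-r) ^ k * risingBinomial (α * k + β - α) n)
          = fun k : ℕ => ∑ p ∈ Finset.HasAntidiagonal.antidiagonal n,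
            risingBinomial (-α) p.1 * ((-r) ^ k * risingBinomial (α * k + β) p.2) := by
        funext k
        rw [show α * (k : ℝ) + β - α = -α + (α * k + β) by ring,
          ← sum_antidiagonal_risingBinomial, Finset.mul_sum]
        exact Finset.sum_congr rfl fun p _ => by ring
      rw [hterm]
      exact h
    have h2 := (hasSum_nat_add_iff' 1).mpr h1
    have h3 := (hsum n).mul_left (-r)
    have h4 : (fun k : ℕ => (-r) ^ (k + 1) * risingBinomial (α * ((k + 1 : ℕ) : ℝ) + β - α) n)
        = fun k : ℕ => -r * ((-r) ^ k * risingBinomial (α * k + β) n) := by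
      funext k
      push_cast
      rw [show α * ((k : ℝ) + 1) + β - α = α * k + β by ring]
      ring
    rw [h4] at h2
    have h5 := h2.unique h3
    simp at h5
    linarith
  show 0 ≤ w n
  induction n using Nat.strong_induction_on with
  | _ n ih =>
    have h := hconv n
    have hc : 0 ≤ risingBinomial (β - α) n := risingBinomial_nonneg (by linarith) n
    cases n with
    | zero =>
      simp at h
      by_contra! hneg
      nlinarith
    | succ n =>
      rw [Finset.Nat.sum_antidiagonal_succ] at h
      have h5 : ∑ p ∈ Finset.HasAntidiagonal.antidiagonal n, risingBinomial (-α) (p.1 + 1) * w p.2 ≤ 0 := by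
        refine Finset.sum_nonpos fun p hp => ?_
        refine mul_nonpos_of_nonpos_of_nonneg (risingBinomial_neg_nonpos hα hα1 _) (ih _ ?_)
        have := Finset.HasAntidiagonal.mem_antidiagonal.mp hp
        omega
      simp at h
      by_contra! hneg
      nlinarith

/-- The two-parameter Mittag-Leffler function `E_{α,β}` at `-x`. -/
noncomputable def mittagLefflerNeg (α β x : ℝ) : ℝ :=
  ∑' k : ℕ, (-x) ^ k / Real.Gamma (α * k + β)

lemma Real.GammaSeq_pos {y : ℝ} (hy : 0 < y) {n : ℕ} (hn : n ≠ 0) : 0 < Real.GammaSeq y n := by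
  rw [Real.GammaSeq]
  have : (0 : ℝ) < n := by positivity
  exact div_pos (by positivity) (Finset.prod_pos fun _ _ => by positivity)

lemma Real.GammaSeq_le_succ {y : ℝ} (hy : 0 < y) {n : ℕ} (hn : n ≠ 0) :
    Real.GammaSeq y n ≤ Real.GammaSeq y (n + 1) := by
  have hn' : (0 : ℝ) < n := by positivity
  have hP : (0 : ℝ) < ∏ j ∈ Finset.range (n + 1), (y + j) :=
    Finset.prod_pos fun _ _ => by positivity
  have hlog : 1 / (n + 1 : ℝ) ≤ Real.log ((n + 1) / n) := by
    refine le_trans (le_of_eq ?_) (Real.one_sub_inv_le_log_of_pos (by positivity))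
    field_simp
    ring
  have hpow : 1 + y / (n + 1) ≤ ((n + 1 : ℝ) / n) ^ y := by
    rw [Real.rpow_def_of_pos (by positivity)]
    have h1 := Real.add_one_le_exp (Real.log ((n + 1 : ℝ) / n) * y)
    have h2 := mul_le_mul_of_nonneg_right hlog hy.le
    have h3 : 1 / (n + 1 : ℝ) * y = y / (n + 1) := by ring
    linarith
  have hpow' : (n : ℝ) ^ y * (y + (n + 1)) ≤ (n + 1 : ℝ) ^ y * (n + 1) := by
    rw [Real.div_rpow (by positivity) hn'.le, le_div_iff₀ (by positivity)] at hpow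
    have h := mul_le_mul_of_nonneg_right hpow (by positivity : (0 : ℝ) ≤ n + 1)
    refine le_trans (le_of_eq ?_) h
    field_simp
    ring
  rw [Real.GammaSeq, Real.GammaSeq, Finset.prod_range_succ _ (n + 1), Nat.factorial_succ,
    div_le_div_iff₀ hP (by positivity)]
  push_cast
  have h := mul_le_mul_of_nonneg_right hpow'
    (by positivity : (0 : ℝ) ≤ n.factorial * ∏ j ∈ Finset.range (n + 1), (y + (j : ℝ)))
  nlinarith [h]

lemma Real.GammaSeq_mono {y : ℝ} (hy : 0 < y) {m n : ℕ} (hm : m ≠ 0) (hmn : m ≤ n) :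
    Real.GammaSeq y m ≤ Real.GammaSeq y n := by
  induction n, hmn using Nat.le_induction with
  | base => rfl
  | succ n hn ih => exact ih.trans (Real.GammaSeq_le_succ hy (by omega))

lemma Real.GammaSeq_le_Gamma {y : ℝ} (hy : 0 < y) {n : ℕ} (hn : n ≠ 0) :
    Real.GammaSeq y n ≤ Real.Gamma y :=
  ge_of_tendsto (Real.GammaSeq_tendsto_Gamma y)
    ((eventually_ge_atTop n).mono fun _ h => Real.GammaSeq_mono hy hn h)

lemma inv_GammaSeq_eq {y : ℝ} {n : ℕ} (hn : n ≠ 0) :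
    (Real.GammaSeq y n)⁻¹ = (n + 1) * (n : ℝ) ^ (-y) * risingBinomial y (n + 1) := by
  have hn' : (0 : ℝ) < n := by positivity
  rw [Real.GammaSeq, risingBinomial, Real.rpow_neg hn'.le, Nat.factorial_succ, inv_div]
  push_cast
  have : (n : ℝ) ^ y ≠ 0 := by positivity
  field_simp

lemma pow_mul_inv_GammaSeq {α β x : ℝ} {n : ℕ} (hn : n ≠ 0) (k : ℕ) :
    x ^ k * (Real.GammaSeq (α * k + β) n)⁻¹ = ((n + 1) * (n : ℝ) ^ (-β)) *
      ((x * (n : ℝ) ^ (-α)) ^ k * risingBinomial (α * k + β) (n + 1)) := by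
  have hn' : (0 : ℝ) < n := by positivity
  rw [inv_GammaSeq_eq hn, mul_pow, ← Real.rpow_natCast ((n : ℝ) ^ (-α)), ← Real.rpow_mul hn'.le,
    neg_add, Real.rpow_add hn', neg_mul]
  ring

lemma eventually_mul_rpow_neg_lt_one {α : ℝ} (hα : 0 < α) (x : ℝ) :
    ∀ᶠ n : ℕ in atTop, x * (n : ℝ) ^ (-α) < 1 := by
  have h := ((tendsto_rpow_neg_atTop hα).comp tendsto_natCast_atTop_atTop).const_mul x
  rw [mul_zero] at h
  exact h.eventually_lt_const one_pos

lemma exists_summable_pow_mul_inv_GammaSeq {α β x : ℝ} (hα : 0 < α) (hβ : 0 < β) (hx : 0 < x) :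
    ∃ N : ℕ, N ≠ 0 ∧ Summable fun k : ℕ => x ^ k * (Real.GammaSeq (α * k + β) N)⁻¹ := by
  obtain ⟨N, hN, hN0⟩ := ((eventually_mul_rpow_neg_lt_one hα x).and (eventually_ne_atTop 0)).exists
  refine ⟨N, hN0, ?_⟩
  simp only [pow_mul_inv_GammaSeq hN0]
  have : (0 : ℝ) < N := by positivity
  exact (summable_pow_mul_risingBinomial hα.le hβ.le (by positivity) hN _).mul_left _

lemma summable_pow_div_Gamma {α β x : ℝ} (hα : 0 < α) (hβ : 0 < β) (hx : 0 < x) :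
    Summable fun k : ℕ => x ^ k / Real.Gamma (α * k + β) := by
  obtain ⟨N, hN, hs⟩ := exists_summable_pow_mul_inv_GammaSeq hα hβ hx
  refine Summable.of_nonneg_of_le (fun k => ?_) (fun k => ?_) hs
  · exact div_nonneg (by positivity) (Real.Gamma_pos_of_pos (by positivity)).le
  · rw [div_eq_mul_inv]
    gcongr
    · exact Real.GammaSeq_pos (by positivity) hN
    · exact Real.GammaSeq_le_Gamma (by positivity) hN

lemma summable_neg_pow_div_Gamma {α β x : ℝ} (hα : 0 < α) (hβ : 0 < β) (hx : 0 < x) :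
    Summable fun k : ℕ => (-x) ^ k / Real.Gamma (α * k + β) := by
  refine Summable.of_norm_bounded (summable_pow_div_Gamma hα hβ hx) fun k => ?_
  rw [norm_div, norm_pow, norm_neg, Real.norm_of_nonneg hx.le,
    Real.norm_of_nonneg (Real.Gamma_pos_of_pos (by positivity)).le]

lemma mittagLefflerNeg_nonneg {α β x : ℝ} (hα : 0 < α) (hα1 : α ≤ 1) (hβ : α ≤ β) (hx : 0 < x) :
    0 ≤ mittagLefflerNeg α β x := by
  have hβ0 : 0 < β := hα.trans_le hβ
  obtain ⟨N, hN, hs⟩ := exists_summable_pow_mul_inv_GammaSeq hα hβ0 hx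
  have hlim : Tendsto (fun n : ℕ => ∑' k : ℕ, (-x) ^ k * (Real.GammaSeq (α * k + β) n)⁻¹) atTop
      (nhds (∑' k : ℕ, (-x) ^ k * (Real.Gamma (α * k + β))⁻¹)) := by
    refine tendsto_tsum_of_dominated_convergence hs (fun k => ?_) ?_
    · exact ((Real.GammaSeq_tendsto_Gamma _).inv₀
        (Real.Gamma_pos_of_pos (by positivity)).ne').const_mul _
    · filter_upwards [eventually_ge_atTop N] with n hn k
      have hy : 0 < α * k + β := by positivity
      rw [norm_mul, norm_pow, norm_neg, Real.norm_of_nonneg hx.le,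
        Real.norm_of_nonneg (inv_nonneg.mpr (Real.GammaSeq_pos hy (by omega)).le)]
      gcongr
      · exact Real.GammaSeq_pos hy hN
      · exact Real.GammaSeq_mono hy hN hn
  simp only [mittagLefflerNeg, div_eq_mul_inv]
  refine ge_of_tendsto hlim ?_
  filter_upwards [eventually_mul_rpow_neg_lt_one hα x, eventually_ne_atTop 0] with n hn hn0
  have : (0 : ℝ) < n := by positivity
  simp only [pow_mul_inv_GammaSeq hn0, neg_mul]
  rw [tsum_mul_left]
  exact mul_nonneg (by positivity)
    (tsum_neg_pow_mul_risingBinomial_nonneg hα.le hα1 hβ (by positivity) hn _)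

lemma mul_mittagLefflerNeg {α β x : ℝ} (hα : 0 < α) (hβ : 0 < β) (hx : 0 < x) :
    x * mittagLefflerNeg α (α + β) x = 1 / Real.Gamma β - mittagLefflerNeg α β x := by
  have h : mittagLefflerNeg α β x = 1 / Real.Gamma β + -x * mittagLefflerNeg α (α + β) x := by
    simp only [mittagLefflerNeg]
    rw [(summable_neg_pow_div_Gamma hα hβ hx).tsum_eq_zero_add, ← tsum_mul_left]
    congr 1
    · simp
    · refine tsum_congr fun k => ?_
      push_cast
      rw [pow_succ, show α * ((k : ℝ) + 1) + β = α * k + (α + β) by ring]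
      ring
  linarith

lemma tendsto_mul_mittagLefflerNeg {α β : ℝ} (hα : 0 < α) (hα1 : α ≤ 1) (hβ : α ≤ β) :
    Tendsto (fun x => x * mittagLefflerNeg α (α + (α + β)) x) atTop
      (nhds (1 / Real.Gamma (α + β))) := by
  have hβ0 : 0 < β := hα.trans_le hβ
  have h0 : Tendsto (fun x => mittagLefflerNeg α (α + β) x) atTop (nhds 0) := by
    refine tendsto_of_tendsto_of_tendsto_of_le_of_le' tendsto_const_nhds
      (tendsto_const_nhds (x := 1 / Real.Gamma β).div_atTop tendsto_id) ?_ ?_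
    · filter_upwards [eventually_gt_atTop 0] with x hx
      exact mittagLefflerNeg_nonneg hα hα1 (by linarith) hx
    · filter_upwards [eventually_gt_atTop 0] with x hx
      rw [id, le_div_iff₀ hx, mul_comm, mul_mittagLefflerNeg hα hβ0 hx]
      linarith [mittagLefflerNeg_nonneg hα hα1 hβ hx]
  have h1 := h0.const_sub (1 / Real.Gamma (α + β))
  rw [sub_zero] at h1
  refine h1.congr' ?_
  filter_upwards [eventually_gt_atTop 0] with x hx
  rw [mul_mittagLefflerNeg hα (by positivity) hx]

/-- The monotone density theorem for power-law asymptotics. -/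
lemma tendsto_div_rpow_of_hasDerivAt_of_monotoneOn {f g : ℝ → ℝ} {c p : ℝ}
    (hf : ∀ t, 0 < t → HasDerivAt f (g t) t) (hg : MonotoneOn g (Set.Ioi 0))
    (h : Tendsto (fun t => f t / t ^ p) atTop (nhds c)) :
    Tendsto (fun t => g t / t ^ (p - 1)) atTop (nhds (c * p)) := by
  have hquot : ∀ ε : ℝ, ε ≠ 0 → -1 < ε →
      Tendsto (fun t => (f ((1 + ε) * t) - f t) / (ε * t) / t ^ (p - 1)) atTop
        (nhds (c * (((1 + ε) ^ p - 1) / ε))) := by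
    intro ε hε hε1
    have hpos : 0 < 1 + ε := by linarith
    have h1 := h.comp (tendsto_id.const_mul_atTop hpos)
    have h2 := ((h1.mul_const ((1 + ε) ^ p)).sub h).div_const ε
    rw [show c * (((1 + ε) ^ p - 1) / ε) = (c * (1 + ε) ^ p - c) / ε by ring]
    refine h2.congr' ?_
    filter_upwards [eventually_gt_atTop 0] with t ht
    simp only [Function.comp, id]
    rw [Real.mul_rpow hpos.le ht.le, Real.rpow_sub_one ht.ne']
    have : (1 + ε) ^ p ≠ 0 := by positivity
    have : t ^ p ≠ 0 := by positivity
    field_simp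
  have hslope : Tendsto (fun ε : ℝ => c * (((1 + ε) ^ p - 1) / ε)) (nhdsWithin 0 {0}ᶜ)
      (nhds (c * p)) := by
    have h1 : HasDerivAt (fun ε : ℝ => (1 + ε) ^ p) p 0 := by
      have := ((hasDerivAt_id (0 : ℝ)).const_add 1).rpow_const (p := p) (by simp)
      simpa using this
    have h2 := (hasDerivAt_iff_tendsto_slope.mp h1).const_mul c
    refine h2.congr fun ε => ?_
    simp [slope_def_field]
  have hmvt : ∀ a b : ℝ, 0 < a → a < b →
      g a ≤ (f b - f a) / (b - a) ∧ (f b - f a) / (b - a) ≤ g b := by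
    intro a b ha hab
    obtain ⟨x, hx, hgx⟩ := exists_hasDerivAt_eq_slope f g hab
      (fun y hy => (hf y (ha.trans_le hy.1)).continuousAt.continuousWithinAt)
      (fun y hy => hf y (ha.trans hy.1))
    rw [← hgx]
    have hx0 : 0 < x := ha.trans hx.1
    exact ⟨hg ha hx0 hx.1.le, hg hx0 (hx0.trans hx.2) hx.2.le⟩
  refine tendsto_order.mpr ⟨fun a ha => ?_, fun a ha => ?_⟩
  · have hl : Tendsto (fun ε : ℝ => c * (((1 + ε) ^ p - 1) / ε)) (nhdsWithin 0 (Set.Iio 0))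
        (nhds (c * p)) := hslope.mono_left (nhdsWithin_mono _ fun x hx => hx.ne)
    obtain ⟨ε, hε, hε1⟩ := ((hl.eventually_const_lt ha).and
      (Ioo_mem_nhdsLT (show (-1 : ℝ) < 0 by norm_num))).exists
    filter_upwards [(hquot ε hε1.2.ne hε1.1).eventually_const_lt hε, eventually_gt_atTop 0]
      with t ht ht0
    refine ht.trans_le ?_
    have hb := (hmvt ((1 + ε) * t) t (mul_pos (by linarith [hε1.1]) ht0)
      (by nlinarith [hε1.2])).2
    gcongr
    refine le_trans (le_of_eq ?_) hb
    rw [← neg_div_neg_eq]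
    congr 1 <;> ring
  · have hl : Tendsto (fun ε : ℝ => c * (((1 + ε) ^ p - 1) / ε)) (nhdsWithin 0 (Set.Ioi 0))
        (nhds (c * p)) := hslope.mono_left (nhdsWithin_mono _ fun x hx => (ne_of_gt hx))
    obtain ⟨ε, hε, hε1⟩ := ((hl.eventually_lt_const ha).and self_mem_nhdsWithin).exists
    have hε0 : 0 < ε := hε1
    filter_upwards [(hquot ε hε0.ne' (by linarith)).eventually_lt_const hε, eventually_gt_atTop 0]
      with t ht ht0
    refine lt_of_le_of_lt ?_ ht
    have hb := (hmvt t ((1 + ε) * t) ht0 (by nlinarith)).1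
    gcongr
    refine hb.trans (le_of_eq ?_)
    congr 1
    ring

lemma rpow_mul_mittagLefflerNeg {α t : ℝ} (β : ℝ) (ht : 0 < t) :
    t ^ (β - 1) * mittagLefflerNeg α β (t ^ α)
      = ∑' k : ℕ, (-1) ^ k * (t ^ (α * k + β - 1) / Real.Gamma (α * k + β)) := by
  rw [mittagLefflerNeg, ← tsum_mul_left]
  refine tsum_congr fun k => ?_
  rw [neg_pow, ← Real.rpow_natCast (t ^ α), ← Real.rpow_mul ht.le, add_sub_assoc,
    Real.rpow_add ht]
  ring

lemma summable_rpow_div_Gamma {α β t : ℝ} (hα : 0 < α) (hβ : 0 ≤ β) (ht : 0 < t) :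
    Summable fun k : ℕ => t ^ (α * k + β - 1) / Real.Gamma (α * k + β) := by
  rw [← summable_nat_add_iff 1]
  refine ((summable_pow_div_Gamma hα (add_pos_of_pos_of_nonneg hα hβ)
    (Real.rpow_pos_of_pos ht α)).mul_left (t ^ (α + β - 1))).congr fun k => ?_
  push_cast
  rw [← Real.rpow_natCast (t ^ α), ← Real.rpow_mul ht.le, ← mul_div_assoc, ← Real.rpow_add ht]
  ring_nf

lemma hasDerivAt_rpow_mul_mittagLefflerNeg {α β t : ℝ} (hα : 0 < α) (hβ : 0 ≤ β) (ht : 0 < t) :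
    HasDerivAt (fun s => s ^ β * mittagLefflerNeg α (β + 1) (s ^ α))
      (t ^ (β - 1) * mittagLefflerNeg α β (t ^ α)) t := by
  have hmem : t ∈ Set.Ioo (t / 2) (2 * t) := ⟨by linarith, by linarith⟩
  have hpos : ∀ s ∈ Set.Ioo (t / 2) (2 * t), 0 < s := fun s hs => by linarith [hs.1]
  have key := hasDerivAt_tsum_of_isPreconnected
    (g := fun (k : ℕ) (s : ℝ) =>
      (-1) ^ k * (s ^ (α * k + (β + 1) - 1) / Real.Gamma (α * k + (β + 1))))
    (g' := fun (k : ℕ) (s : ℝ) => (-1) ^ k * (s ^ (α * k + β - 1) / Real.Gamma (α * k + β)))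
    (u := fun k : ℕ => (t / 2) ^ (α * k + β - 1) / Real.Gamma (α * k + β)
      + (2 * t) ^ (α * k + β - 1) / Real.Gamma (α * k + β))
    ((summable_rpow_div_Gamma hα hβ (by linarith)).add
      (summable_rpow_div_Gamma hα hβ (by linarith)))
    isOpen_Ioo isPreconnected_Ioo ?_ ?_ hmem ?_ hmem
  · rw [rpow_mul_mittagLefflerNeg β ht]
    refine key.congr_of_eventuallyEq ?_
    filter_upwards [Ioi_mem_nhds ht] with s hs
    rw [← rpow_mul_mittagLefflerNeg (β + 1) hs, add_sub_cancel_right]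
  · intro k s hs
    have hs0 := hpos s hs
    have h1 := ((Real.hasDerivAt_rpow_const (p := α * k + β) (Or.inl hs0.ne')).div_const
      (Real.Gamma (α * k + (β + 1)))).const_mul ((-1 : ℝ) ^ k)
    have e : α * (k : ℝ) + (β + 1) - 1 = α * k + β := by ring
    simp only [e]
    refine h1.congr_deriv ?_
    rcases eq_or_ne (α * (k : ℝ) + β) 0 with h0 | h0
    · simp [h0]
    · rw [← add_assoc, Real.Gamma_add_one h0, mul_div_mul_left _ _ h0]
  · intro k s hs
    have hs0 := hpos s hs
    have hG : 0 ≤ Real.Gamma (α * k + β) := Real.Gamma_nonneg_of_nonneg (by positivity)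
    rw [norm_mul, norm_pow, norm_neg, norm_one, one_pow, one_mul,
      Real.norm_of_nonneg (by positivity), ← add_div]
    gcongr
    rcases le_total 0 (α * (k : ℝ) + β - 1) with h | h
    · exact (Real.rpow_le_rpow hs0.le hs.2.le h).trans
        (le_add_of_nonneg_left (by positivity))
    · exact (Real.rpow_le_rpow_of_nonpos (by linarith) hs.1.le h).trans
        (le_add_of_nonneg_right (by positivity))
  · refine Summable.of_norm_bounded (summable_rpow_div_Gamma hα (by linarith : 0 ≤ β + 1) ht)
      fun k => ?_
    have hG : 0 ≤ Real.Gamma (α * k + (β + 1)) := Real.Gamma_nonneg_of_nonneg (by positivity)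
    rw [norm_mul, norm_pow, norm_neg, norm_one, one_pow, one_mul,
      Real.norm_of_nonneg (by positivity)]

lemma mittagLefflerNeg_zero_nonpos {α x : ℝ} (hα : 0 < α) (hα1 : α ≤ 1) (hx : 0 < x) :
    mittagLefflerNeg α 0 x ≤ 0 := by
  have hs : Summable fun k : ℕ => (-x) ^ k / Real.Gamma (α * k + 0) := by
    rw [← summable_nat_add_iff 1]
    refine ((summable_neg_pow_div_Gamma hα hα hx).mul_left (-x)).congr fun k => ?_
    push_cast
    rw [show α * ((k : ℝ) + 1) + 0 = α * k + α by ring]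
    ring
  have h : mittagLefflerNeg α 0 x = -x * mittagLefflerNeg α α x := by
    simp only [mittagLefflerNeg]
    rw [hs.tsum_eq_zero_add, ← tsum_mul_left]
    simp only [Nat.cast_zero, mul_zero, add_zero, Real.Gamma_zero, div_zero, zero_add]
    refine tsum_congr fun k => ?_
    push_cast
    rw [pow_succ, show α * ((k : ℝ) + 1) = α * k + α by ring]
    ring
  rw [h]
  nlinarith [mittagLefflerNeg_nonneg hα hα1 le_rfl hx]

/-- Algebraic decay asymptotics of the Mittag-Leffler function:
`x · E_α(-x) → 1/Γ(1-α)` as `x → +∞`, i.e. `E_α(-x) ∼ 1/(x Γ(1-α))`. -/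
theorem mittagLeffler_algebraic_decay
    (α : ℝ) (hα : α ∈ Set.Ioo (0:ℝ) 1) :
    Tendsto (fun x : ℝ => x * ∑' n : ℕ, (-x) ^ n / Real.Gamma (1 + (n : ℝ) * α))
      atTop (nhds (1 / Real.Gamma (1 - α))) := by
  obtain ⟨h0, h1⟩ := hα
  have d1 : ∀ t : ℝ, 0 < t → HasDerivAt (fun s => s ^ (0 : ℝ) * mittagLefflerNeg α 1 (s ^ α))
      (t ^ (0 - 1 : ℝ) * mittagLefflerNeg α 0 (t ^ α)) t := fun t ht => by
    simpa only [zero_add] using hasDerivAt_rpow_mul_mittagLefflerNeg h0 le_rfl ht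
  have d2 : ∀ t : ℝ, 0 < t → HasDerivAt (fun s => s ^ (1 : ℝ) * mittagLefflerNeg α 2 (s ^ α))
      (t ^ (0 : ℝ) * mittagLefflerNeg α 1 (t ^ α)) t := fun t ht => by
    have h := hasDerivAt_rpow_mul_mittagLefflerNeg h0 zero_le_one ht
    norm_num at h ⊢
    exact h
  have d3 : ∀ t : ℝ, 0 < t → HasDerivAt (fun s => s ^ (2 : ℝ) * mittagLefflerNeg α 3 (s ^ α))
      (t ^ (1 : ℝ) * mittagLefflerNeg α 2 (t ^ α)) t := fun t ht => by
    have h := hasDerivAt_rpow_mul_mittagLefflerNeg h0 zero_le_two ht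
    have e : (2 - 1 : ℝ) = 1 ∧ (2 + 1 : ℝ) = 3 := by norm_num
    rwa [e.1, e.2] at h
  have anti1 : AntitoneOn (fun s => s ^ (0 : ℝ) * mittagLefflerNeg α 1 (s ^ α)) (Set.Ioi 0) := by
    refine antitoneOn_of_deriv_nonpos (convex_Ioi 0)
      (fun t ht => (d1 t ht).continuousAt.continuousWithinAt) ?_ ?_ <;> rw [interior_Ioi]
    · exact fun t ht => (d1 t ht).differentiableAt.differentiableWithinAt
    · intro t ht
      have ht' : 0 < t := ht
      rw [(d1 t ht).deriv]
      exact mul_nonpos_of_nonneg_of_nonpos (by positivity)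
        (mittagLefflerNeg_zero_nonpos h0 h1.le (by positivity))
  have mono2 : MonotoneOn (fun s => s ^ (1 : ℝ) * mittagLefflerNeg α 2 (s ^ α)) (Set.Ioi 0) := by
    refine monotoneOn_of_deriv_nonneg (convex_Ioi 0)
      (fun t ht => (d2 t ht).continuousAt.continuousWithinAt) ?_ ?_ <;> rw [interior_Ioi]
    · exact fun t ht => (d2 t ht).differentiableAt.differentiableWithinAt
    · intro t ht
      have ht' : 0 < t := ht
      rw [(d2 t ht).deriv]
      exact mul_nonneg (by positivity) (mittagLefflerNeg_nonneg h0 h1.le h1.le (by positivity))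
  have lim3 : Tendsto (fun t => t ^ (2 : ℝ) * mittagLefflerNeg α 3 (t ^ α) / t ^ (2 - α)) atTop
      (nhds (1 / Real.Gamma (3 - α))) := by
    have h := (tendsto_mul_mittagLefflerNeg h0 h1.le (by linarith : α ≤ 3 - 2 * α)).comp
      (tendsto_rpow_atTop h0)
    rw [show α + (3 - 2 * α) = 3 - α by ring, show α + (3 - α) = 3 by ring] at h
    refine h.congr' ?_
    filter_upwards [eventually_gt_atTop 0] with t ht
    rw [Function.comp, Real.rpow_sub ht]
    have : t ^ (2 : ℝ) ≠ 0 := by positivity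
    field_simp
  have lim2 := tendsto_div_rpow_of_hasDerivAt_of_monotoneOn d3 mono2 lim3
  have lim1 := (tendsto_div_rpow_of_hasDerivAt_of_monotoneOn
    (fun t ht => (d2 t ht).neg) anti1.neg (c := -(1 / Real.Gamma (3 - α) * (2 - α)))
    (p := 2 - α - 1) (by simpa only [Pi.neg_apply, neg_div] using lim2.neg)).neg
  have hval : -(-(1 / Real.Gamma (3 - α) * (2 - α)) * (2 - α - 1)) = 1 / Real.Gamma (1 - α) := by
    have e1 := Real.Gamma_add_one (s := 1 - α) (by linarith)
    have e2 := Real.Gamma_add_one (s := 1 - α + 1) (by linarith)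
    have hG : Real.Gamma (1 - α) ≠ 0 := (Real.Gamma_pos_of_pos (by linarith)).ne'
    have n1 : 1 - α ≠ 0 := by linarith
    have n2 : 2 - α ≠ 0 := by linarith
    rw [show 3 - α = 1 - α + 1 + 1 by ring, e2, e1, show 1 - α + 1 = 2 - α by ring,
      show 2 - α - 1 = 1 - α by ring]
    field_simp
  rw [hval] at lim1
  refine (lim1.comp (tendsto_rpow_atTop (inv_pos.mpr h0))).congr' ?_
  filter_upwards [eventually_gt_atTop 0] with x hx
  have hx' : (x ^ α⁻¹) ^ α = x := Real.rpow_inv_rpow hx.le h0.ne'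
  have hx2 : (x ^ α⁻¹) ^ (2 - α - 1 - 1) = x⁻¹ := by
    rw [show 2 - α - 1 - 1 = -α by ring, Real.rpow_neg (by positivity), hx']
  simp only [Function.comp, hx', hx2, Real.rpow_zero, one_mul]
  rw [div_inv_eq_mul, neg_mul, neg_neg, mul_comm, mittagLefflerNeg]
  simp only [mul_comm α, add_comm _ (1 : ℝ)]
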